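/- arXiv:2208.07586 — 2 statements merged into one kernel-verified Lean document; each statement's English description precedes it below -/
import Mathlib

section
/- Let l be a positive integer and define E = A_{2l+1} ∪ (2^(2l+1) − 2 + B_{2l+1}) ∪ (2^(2l+2) − 2 + (B_{2l+1} ∩ [0, 2^(2l+1) − 3])) ∪ {3·2^(2l+1) − 4} and F = B_{2l+1} ∪ (2^(2l+1) − 2 + A_{2l+1}) ∪ (2^(2l+2) − 2 + (A_{2l+1} ∩ [0, 2^(2l+1) − 3])). Then E ∪ F = [0, 3·2^(2l+1) − 4], 0 ∈ E, E ∩ F = {2^(2l+1) − 2, 2^(2l+1) − 1}, and R_E(n) = R_F(n) for every integer n ∈ [0, 3·2^(2l+1) − 4]. -/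
/-- `R S n` is the number of pairs `(s, s')` with `s, s' ∈ S`, `s < s'` and `s + s' = n`. -/
noncomputable def R (S : Set ℕ) (n : ℕ) : ℕ :=
  Set.ncard {p : ℕ × ℕ | p.1 ∈ S ∧ p.2 ∈ S ∧ p.1 < p.2 ∧ p.1 + p.2 = n}

/-- `AP r m` is the arithmetic progression `r + mℕ = {r + m*k : k ∈ ℕ}`. -/
def AP (r m : ℕ) : Set ℕ := {n | ∃ k : ℕ, n = r + m * k}

/-- The Thue–Morse set: nonnegative integers with an even number of binary digits 1. -/
def TMA : Set ℕ := {n | Even ((Nat.digits 2 n).sum)}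

/-- Complement of the Thue–Morse set. -/
def TMB : Set ℕ := {n | ¬ Even ((Nat.digits 2 n).sum)}

/-- `TMAl l = A ∩ [0, 2^l - 1]`. -/
def TMAl (l : ℕ) : Set ℕ := TMA ∩ Set.Icc 0 (2 ^ l - 1)

/-- `TMBl l = B ∩ [0, 2^l - 1]`. -/
def TMBl (l : ℕ) : Set ℕ := TMB ∩ Set.Icc 0 (2 ^ l - 1)

/-- The set `E` of Claim 3. -/
def Eset (l : ℕ) : Set ℕ :=
  TMAl (2 * l + 1) ∪ ((fun x => 2 ^ (2 * l + 1) - 2 + x) '' TMBl (2 * l + 1)) ∪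
    ((fun x => 2 ^ (2 * l + 2) - 2 + x) ''
      (TMBl (2 * l + 1) ∩ Set.Icc 0 (2 ^ (2 * l + 1) - 3))) ∪
    {3 * 2 ^ (2 * l + 1) - 4}

/-- The set `F` of Claim 3. -/
def Fset (l : ℕ) : Set ℕ :=
  TMBl (2 * l + 1) ∪ ((fun x => 2 ^ (2 * l + 1) - 2 + x) '' TMAl (2 * l + 1)) ∪
    ((fun x => 2 ^ (2 * l + 2) - 2 + x) ''
      (TMAl (2 * l + 1) ∩ Set.Icc 0 (2 ^ (2 * l + 1) - 3)))

open Polynomial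
open Finset.HasAntidiagonal (antidiagonal mem_antidiagonal)

open Classical in
/-- The polynomial `∑ x ^ i` over the `i ∈ S` with `i < K`. -/
noncomputable def indicatorPoly (S : Set ℕ) (K : ℕ) : ℤ[X] :=
  ∑ i ∈ Finset.range K, monomial i (if i ∈ S then 1 else 0)

open Classical in
theorem coeff_indicatorPoly (S : Set ℕ) (K n : ℕ) :
    (indicatorPoly S K).coeff n = if n < K ∧ n ∈ S then 1 else 0 := by
  simp only [indicatorPoly, finsetSum_coeff, coeff_monomial,
    Finset.sum_ite_eq', Finset.mem_range]
  split_ifs <;> simp_all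

open Classical in
/-- Ordered representations of `n` are twice the representations counted by `R`, plus the
diagonal one. -/
theorem coeff_indicatorPoly_sq (S : Set ℕ) {K n : ℕ} (hn : n < K) :
    (indicatorPoly S K ^ 2).coeff n =
      2 * R S n + (expand ℤ 2 (indicatorPoly S K)).coeff n := by
  have hR : R S n = ((antidiagonal n).filter
      fun p => p.1 ∈ S ∧ p.2 ∈ S ∧ p.1 < p.2).card := by
    rw [R, ← Set.ncard_coe_finset]
    congr 1
    ext p
    simp
    tauto
  have hswap : ((antidiagonal n).filter fun p => p.1 ∈ S ∧ p.2 ∈ S ∧ p.1 < p.2).card =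
      ((antidiagonal n).filter fun p => p.1 ∈ S ∧ p.2 ∈ S ∧ p.2 < p.1).card := by
    refine Finset.card_bij (fun p _ => p.swap) ?_ ?_ ?_
    · rintro ⟨a, b⟩ h
      simp at h ⊢
      exact ⟨by omega, by tauto⟩
    · rintro ⟨a, b⟩ _ ⟨c, d⟩ _ h
      simpa [and_comm] using h
    · rintro ⟨a, b⟩ h
      simp at h
      exact ⟨(b, a), by simp; exact ⟨by omega, by tauto⟩, rfl⟩
  have hdiag : (expand ℤ 2 (indicatorPoly S K)).coeff n =
      ((antidiagonal n).filter fun p => p.1 ∈ S ∧ p.2 ∈ S ∧ p.1 = p.2).card := by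
    rw [coeff_expand two_pos, coeff_indicatorPoly]
    by_cases h : 2 ∣ n ∧ n / 2 ∈ S
    · have : (antidiagonal n).filter (fun p => p.1 ∈ S ∧ p.2 ∈ S ∧ p.1 = p.2) =
          {(n / 2, n / 2)} := by
        ext ⟨a, b⟩
        simp only [Finset.mem_filter, mem_antidiagonal, Finset.mem_singleton,
          Prod.mk.injEq]
        constructor
        · rintro ⟨h1, -, -, h2⟩
          omega
        · rintro ⟨rfl, rfl⟩
          exact ⟨by omega, h.2, h.2, rfl⟩
      rw [this, if_pos h.1, if_pos ⟨by omega, h.2⟩]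
      simp
    · have : (antidiagonal n).filter (fun p => p.1 ∈ S ∧ p.2 ∈ S ∧ p.1 = p.2) = ∅ := by
        rw [Finset.filter_eq_empty_iff]
        rintro ⟨a, b⟩ hab ⟨ha, -, h'⟩
        simp only [mem_antidiagonal] at hab ha h'
        refine h ⟨by omega, ?_⟩
        rwa [show n / 2 = a by omega]
      rw [this]
      split_ifs <;> simp_all
  rw [hdiag, two_mul]
  conv_lhs => rw [sq, coeff_mul]
  conv_rhs => rw [hR]; arg 1; arg 2; rw [hswap]
  simp only [Finset.card_filter, Nat.cast_sum, ← Finset.sum_add_distrib]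
  refine Finset.sum_congr rfl ?_
  rintro ⟨a, b⟩ hab
  simp only [mem_antidiagonal] at hab
  have ha : a < K := by omega
  have hb : b < K := by omega
  simp only [coeff_indicatorPoly, ha, hb, true_and]
  rcases lt_trichotomy a b with h | h | h <;> by_cases h1 : a ∈ S <;> by_cases h2 : b ∈ S <;>
    grind

open Classical in
/-- The Thue–Morse sign of `n`: `1` on `TMA` and `-1` on `TMB`. -/
noncomputable def thueMorseSign (n : ℕ) : ℤ := if n ∈ TMA then 1 else -1

theorem thueMorseSign_eq_neg_one_pow (n : ℕ) :
    thueMorseSign n = (-1) ^ (Nat.digits 2 n).sum := by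
  unfold thueMorseSign
  split_ifs with h
  · exact (Even.neg_one_pow h).symm
  · exact (Odd.neg_one_pow (Nat.not_even_iff_odd.mp h)).symm

theorem thueMorseSign_zero : thueMorseSign 0 = 1 := by
  simp [thueMorseSign_eq_neg_one_pow]

theorem thueMorseSign_two_mul (n : ℕ) : thueMorseSign (2 * n) = thueMorseSign n := by
  rcases Nat.eq_zero_or_pos n with rfl | h
  · rfl
  · rw [thueMorseSign_eq_neg_one_pow, thueMorseSign_eq_neg_one_pow,
      Nat.digits_def' (by norm_num) (by omega)]
    simp

theorem thueMorseSign_two_mul_add_one (n : ℕ) :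
    thueMorseSign (2 * n + 1) = -thueMorseSign n := by
  rw [thueMorseSign_eq_neg_one_pow, thueMorseSign_eq_neg_one_pow,
    Nat.digits_def' (by norm_num) (by omega)]
  have : (2 * n + 1) / 2 = n := by omega
  simp [this, pow_add, Nat.add_mod]

theorem thueMorseSign_two_pow_sub_one (k : ℕ) : thueMorseSign (2 ^ k - 1) = (-1) ^ k := by
  induction k with
  | zero => simp [thueMorseSign_zero]
  | succ k ih =>
    have : 2 ^ (k + 1) - 1 = 2 * (2 ^ k - 1) + 1 := by
      have := Nat.one_le_two_pow (n := k)
      omega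
    rw [this, thueMorseSign_two_mul_add_one, ih]
    ring

theorem mem_TMA_iff (n : ℕ) : n ∈ TMA ↔ thueMorseSign n = 1 := by
  unfold thueMorseSign
  split_ifs with h <;> simp [h]

theorem mem_TMB_iff (n : ℕ) : n ∈ TMB ↔ thueMorseSign n = -1 := by
  have : n ∈ TMB ↔ n ∉ TMA := Iff.rfl
  rw [this]
  unfold thueMorseSign
  split_ifs with h <;> simp [h]

theorem thueMorseSign_eq_or (n : ℕ) : thueMorseSign n = 1 ∨ thueMorseSign n = -1 := by
  unfold thueMorseSign
  split_ifs <;> simp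

/-- The product `(1 - x)(1 - x ^ 2) ⋯ (1 - x ^ (2 ^ (k - 1)))`, whose coefficients are the first
`2 ^ k` Thue–Morse signs. -/
noncomputable def thueMorsePoly (k : ℕ) : ℤ[X] := ∏ i ∈ Finset.range k, (1 - X ^ 2 ^ i)

theorem thueMorsePoly_mul (k : ℕ) :
    thueMorsePoly k * (1 - X ^ 2 ^ k) = (1 - X) * expand ℤ 2 (thueMorsePoly k) := by
  have h := Finset.prod_range_succ' (fun i => (1 - X ^ 2 ^ i : ℤ[X])) k
  rw [Finset.prod_range_succ] at h
  rw [thueMorsePoly, h, map_prod, mul_comm]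
  simp only [map_sub, map_one, map_pow, expand_X, ← pow_mul, pow_succ' 2,
    pow_zero, pow_one]

theorem coeff_thueMorsePoly (k n : ℕ) :
    (thueMorsePoly k).coeff n = if n < 2 ^ k then thueMorseSign n else 0 := by
  induction k generalizing n with
  | zero =>
    rcases n with _ | n
    · simp [thueMorsePoly, thueMorseSign_zero]
    · simp [thueMorsePoly, coeff_one]
  | succ k ih =>
    have h : thueMorsePoly (k + 1) = (1 - X) * expand ℤ 2 (thueMorsePoly k) := by
      rw [← thueMorsePoly_mul, thueMorsePoly, Finset.prod_range_succ, thueMorsePoly]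
    rw [h, sub_mul, one_mul, coeff_sub, pow_succ']
    rcases Nat.even_or_odd' n with ⟨j, rfl | rfl⟩
    · have h0 : (X * expand ℤ 2 (thueMorsePoly k)).coeff (2 * j) = 0 := by
        rcases j with _ | j
        · simp
        · rw [show 2 * (j + 1) = (2 * j + 1) + 1 by ring, coeff_X_mul, coeff_expand two_pos,
            if_neg (by omega)]
      rw [h0, coeff_expand two_pos, if_pos (by omega), Nat.mul_div_cancel_left _ two_pos, ih,
        thueMorseSign_two_mul]
      simp
    · rw [coeff_X_mul, coeff_expand two_pos, coeff_expand two_pos, if_neg (by omega),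
        if_pos (by omega), Nat.mul_div_cancel_left _ two_pos, ih, thueMorseSign_two_mul_add_one]
      split_ifs <;> omega

theorem mem_Eset_iff {l m : ℕ} (hm : 2 ^ (2 * l + 1) = m + 2) (hm1 : 1 ≤ m) (n : ℕ) :
    n ∈ Eset l ↔ (n < m + 2 ∧ thueMorseSign n = 1) ∨
      (m ≤ n ∧ n < 2 * m + 2 ∧ thueMorseSign (n - m) = -1) ∨
      (2 * m + 2 ≤ n ∧ n < 3 * m + 2 ∧ thueMorseSign (n - (2 * m + 2)) = -1) ∨
      n = 3 * m + 2 := by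
  have h2 : 2 ^ (2 * l + 2) - 2 = 2 * m + 2 := by
    rw [pow_succ, hm]
    omega
  simp only [Eset, TMAl, TMBl, h2, hm, Set.mem_union, Set.mem_inter_iff, Set.mem_image,
    Set.mem_Icc, Set.mem_singleton_iff, mem_TMA_iff, mem_TMB_iff, or_assoc]
  refine or_congr ?_ (or_congr ?_ (or_congr ?_ ?_))
  · constructor
    · rintro ⟨h, -, h'⟩
      exact ⟨by omega, h⟩
    · rintro ⟨h, h'⟩
      exact ⟨h', by omega, by omega⟩
  · constructor
    · rintro ⟨x, ⟨h, -, h'⟩, rfl⟩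
      refine ⟨by omega, by omega, ?_⟩
      rwa [show m + 2 - 2 + x - m = x by omega]
    · rintro ⟨h, h', h''⟩
      exact ⟨n - m, ⟨h'', by omega, by omega⟩, by omega⟩
  · constructor
    · rintro ⟨x, ⟨⟨h, -, -⟩, -, h'⟩, rfl⟩
      refine ⟨by omega, by omega, ?_⟩
      rwa [Nat.add_sub_cancel_left]
    · rintro ⟨h, h', h''⟩
      exact ⟨n - (2 * m + 2), ⟨⟨h'', by omega, by omega⟩, by omega, by omega⟩, by omega⟩
  · omega

theorem mem_Fset_iff {l m : ℕ} (hm : 2 ^ (2 * l + 1) = m + 2) (hm1 : 1 ≤ m) (n : ℕ) :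
    n ∈ Fset l ↔ (n < m + 2 ∧ thueMorseSign n = -1) ∨
      (m ≤ n ∧ n < 2 * m + 2 ∧ thueMorseSign (n - m) = 1) ∨
      (2 * m + 2 ≤ n ∧ n < 3 * m + 2 ∧ thueMorseSign (n - (2 * m + 2)) = 1) := by
  have h2 : 2 ^ (2 * l + 2) - 2 = 2 * m + 2 := by
    rw [pow_succ, hm]
    omega
  simp only [Fset, TMAl, TMBl, h2, hm, Set.mem_union, Set.mem_inter_iff, Set.mem_image,
    Set.mem_Icc, mem_TMA_iff, mem_TMB_iff, or_assoc]
  refine or_congr ?_ (or_congr ?_ ?_)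
  · constructor
    · rintro ⟨h, -, h'⟩
      exact ⟨by omega, h⟩
    · rintro ⟨h, h'⟩
      exact ⟨h', by omega, by omega⟩
  · constructor
    · rintro ⟨x, ⟨h, -, h'⟩, rfl⟩
      refine ⟨by omega, by omega, ?_⟩
      rwa [show m + 2 - 2 + x - m = x by omega]
    · rintro ⟨h, h', h''⟩
      exact ⟨n - m, ⟨h'', by omega, by omega⟩, by omega⟩
  · constructor
    · rintro ⟨x, ⟨⟨h, -, -⟩, -, h'⟩, rfl⟩
      refine ⟨by omega, by omega, ?_⟩
      rwa [Nat.add_sub_cancel_left]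
    · rintro ⟨h, h', h''⟩
      exact ⟨n - (2 * m + 2), ⟨⟨h'', by omega, by omega⟩, by omega, by omega⟩, by omega⟩

/-- The factorization behind the equality of representation functions: `s` and `d` stand for the
sum and the difference of the two generating functions, `d'` for `d` at `x ^ 2`. -/
theorem mul_sub_eq_pow_mul {A : Type*} [CommRing A] {x z S T T' s d d' : A}
    (hT' : T' = 1 + x ^ 2 * S)
    (hT : T * (1 - x ^ 2 * (x * z)) = (1 - x) * T')
    (hs : (1 - x) * s = 1 + x * z - x ^ 2 * (x * z) - x ^ 3 * (x * z) ^ 3)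
    (hd : d = T * (1 - x * z - x ^ 2 * (x * z) ^ 2) + 2 * (x ^ 2 * (x * z) ^ 3)
      - x ^ 3 * (x * z) ^ 3)
    (hd' : d' = T' * (1 - (x * z) ^ 2 - x ^ 4 * (x * z) ^ 4) + 2 * (x ^ 4 * (x * z) ^ 6)
      - x ^ 6 * (x * z) ^ 6) :
    (1 - x) * (1 - x ^ 2 * (x * z)) * (s * d - d') = x ^ 3 * (x * z) ^ 3 *
      (2 * z + 2 * x - 2 * x * S - x ^ 2 + x ^ 2 * S - 4 * x ^ 2 * z + 2 * x ^ 3 * S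
        + x ^ 3 * z + x ^ 3 * z * S - 2 * x ^ 3 * z ^ 2 - x ^ 4 * S + 2 * x ^ 4 * z ^ 2
        - 2 * x ^ 4 * z ^ 3 - x ^ 5 * z * S + x ^ 6 * z ^ 2 * S + 2 * x ^ 6 * z ^ 3
        - 2 * x ^ 7 * z ^ 2 * S - x ^ 7 * z ^ 3 + 2 * x ^ 7 * z ^ 4 + x ^ 8 * z ^ 2 * S
        - 2 * x ^ 9 * z ^ 4 + x ^ 10 * z ^ 4) := by
  have h : (1 - x ^ 2 * (x * z)) * d = (1 - x) * T' * (1 - x * z - x ^ 2 * (x * z) ^ 2) +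
      (1 - x ^ 2 * (x * z)) * (2 * (x ^ 2 * (x * z) ^ 3) - x ^ 3 * (x * z) ^ 3) := by
    rw [hd, ← hT]
    ring
  calc _ = ((1 - x) * s) * ((1 - x ^ 2 * (x * z)) * d) -
        (1 - x) * (1 - x ^ 2 * (x * z)) * d' := by ring
    _ = _ := by
      rw [hs, h, hd', hT']
      ring

theorem X_pow_dvd_of_dvd_one_sub_mul {a k : ℕ} (hk : k ≠ 0) {p : ℤ[X]}
    (h : X ^ a ∣ (1 - X ^ k) * p) : X ^ a ∣ p := by
  have : IsCoprime (X : ℤ[X]) (1 - X ^ k) := by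
    refine ⟨X ^ (k - 1), 1, ?_⟩
    rw [← pow_succ, Nat.sub_add_cancel (Nat.one_le_iff_ne_zero.mpr hk)]
    ring
  exact this.pow_left.dvd_of_dvd_mul_left h

theorem stmt_7 (l : ℕ) (hl : 0 < l) :
    Eset l ∪ Fset l = Set.Icc 0 (3 * 2 ^ (2 * l + 1) - 4) ∧ 0 ∈ Eset l ∧
    Eset l ∩ Fset l = {2 ^ (2 * l + 1) - 2, 2 ^ (2 * l + 1) - 1} ∧
    ∀ n ≤ 3 * 2 ^ (2 * l + 1) - 4, R (Eset l) n = R (Fset l) n := by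
  classical
  obtain ⟨m, hm, hm2⟩ : ∃ m, 2 ^ (2 * l + 1) = m + 2 ∧ 2 ≤ m := by
    have : 2 ^ 3 ≤ 2 ^ (2 * l + 1) := Nat.pow_le_pow_right two_pos (by omega)
    exact ⟨2 ^ (2 * l + 1) - 2, by omega, by omega⟩
  have s0 : thueMorseSign 0 = 1 := thueMorseSign_zero
  have s1 : thueMorseSign 1 = -1 := by
    simpa [s0] using thueMorseSign_two_mul_add_one 0
  have sm1 : thueMorseSign (m + 1) = -1 := by
    have := thueMorseSign_two_pow_sub_one (2 * l + 1)
    rw [hm] at this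
    rw [show m + 1 = m + 2 - 1 by omega, this]
    exact (odd_two_mul_add_one l).neg_one_pow
  have sm : thueMorseSign m = 1 := by
    have := thueMorseSign_two_pow_sub_one (2 * l)
    rw [(even_two_mul l).neg_one_pow, ← thueMorseSign_two_mul] at this
    rwa [show m = 2 * (2 ^ (2 * l) - 1) by rw [pow_succ] at hm; omega]
  have hE := mem_Eset_iff hm (by omega)
  have hF := mem_Fset_iff hm (by omega)
  have key (n : ℕ) : ((n ∈ Eset l ∨ n ∈ Fset l) ↔ n ≤ 3 * m + 2) ∧
      ((n ∈ Eset l ∧ n ∈ Fset l) ↔ (n = m ∨ n = m + 1)) := by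
    rw [hE, hF]
    have h0 : n = m → thueMorseSign n = 1 ∧ thueMorseSign (n - m) = 1 := by
      rintro rfl
      simp [sm, s0]
    have h1 : n = m + 1 → thueMorseSign n = -1 ∧ thueMorseSign (n - m) = -1 := by
      rintro rfl
      simp [sm1, s1]
    rcases thueMorseSign_eq_or n with hu | hu <;>
      rcases thueMorseSign_eq_or (n - m) with hv | hv <;>
      rcases thueMorseSign_eq_or (n - (2 * m + 2)) with hw | hw <;>
      simp only [hu, hv, hw] at h0 h1 ⊢ <;> norm_num at h0 h1 ⊢ <;> omega
  refine ⟨?_, ?_, ?_, ?_⟩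
  · ext n
    rw [Set.mem_union, (key n).1, Set.mem_Icc, hm]
    omega
  · rw [hE]
    exact Or.inl ⟨by omega, s0⟩
  · ext n
    rw [Set.mem_inter_iff, (key n).2, hm]
    simp only [Set.mem_insert_iff, Set.mem_singleton_iff]
    omega
  intro n hn
  rw [hm] at hn
  set e := indicatorPoly (Eset l) (3 * m + 3) with he
  set f := indicatorPoly (Fset l) (3 * m + 3) with hf
  set T := thueMorsePoly (2 * l + 1) with hTdef
  have hsum : e + f = ∑ i ∈ Finset.range (3 * m + 3), (X : ℤ[X]) ^ i + X ^ m + X ^ (m + 1) := by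
    ext i
    have := key i
    simp only [he, hf, coeff_add, coeff_indicatorPoly, finsetSum_coeff, coeff_X_pow,
      Finset.sum_ite_eq, Finset.mem_range]
    by_cases h1 : i ∈ Eset l <;> by_cases h2 : i ∈ Fset l <;>
      simp only [h1, h2, and_true, and_false, if_false, or_true, or_false,
        true_iff, false_iff] at this ⊢ <;> split_ifs <;> omega
  have hdiff : e - f = T * (1 - X ^ m - X ^ (2 * m + 2)) + 2 * X ^ (3 * m + 2)
      - X ^ (3 * m + 3) := by
    ext i
    have hT (j : ℕ) : T.coeff j = if j < m + 2 then thueMorseSign j else 0 := by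
      rw [hTdef, coeff_thueMorsePoly, hm]
    have h2 : (2 * X ^ (3 * m + 2) : ℤ[X]) = X ^ (3 * m + 2) + X ^ (3 * m + 2) := two_mul _
    simp only [h2, mul_sub, mul_one, coeff_sub, coeff_add, coeff_mul_X_pow', hT, coeff_X_pow,
      he, hf, coeff_indicatorPoly, hE, hF]
    have h0 : i = m → thueMorseSign i = 1 ∧ thueMorseSign (i - m) = 1 := by
      rintro rfl
      simp [sm, s0]
    have h1 : i = m + 1 → thueMorseSign i = -1 ∧ thueMorseSign (i - m) = -1 := by
      rintro rfl
      simp [sm1, s1]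
    have h3 : i = 3 * m + 2 → thueMorseSign (i - (2 * m + 2)) = 1 := by
      rintro rfl
      rwa [show 3 * m + 2 - (2 * m + 2) = m by omega]
    have h4 : i = 3 * m + 3 → thueMorseSign (i - (2 * m + 2)) = -1 := by
      rintro rfl
      rwa [show 3 * m + 3 - (2 * m + 2) = m + 1 by omega]
    clear key hsum
    rcases thueMorseSign_eq_or i with hu | hu <;>
      rcases thueMorseSign_eq_or (i - m) with hv | hv <;>
      rcases thueMorseSign_eq_or (i - (2 * m + 2)) with hw | hw <;>
      simp only [hu, hv, hw] at h0 h1 h3 h4 ⊢ <;> norm_num at h0 h1 h3 h4 ⊢ <;>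
      clear hE hF hT he hf hTdef h2 s0 s1 sm sm1 hu hv hw <;> grind
  have hdvd : (X : ℤ[X]) ^ (3 * m + 3) ∣ (e + f) * (e - f) - expand ℤ 2 (e - f) := by
    obtain ⟨k, rfl⟩ : ∃ k, m = k + 1 := ⟨m - 1, by omega⟩
    obtain ⟨S, hS⟩ : (X : ℤ[X]) ∣ T - 1 := by
      rw [X_dvd_iff, coeff_sub, hTdef, coeff_thueMorsePoly, s0, hm]
      simp
    have hT := thueMorsePoly_mul (2 * l + 1)
    rw [hm, ← hTdef] at hT
    refine X_pow_dvd_of_dvd_one_sub_mul one_ne_zero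
      (X_pow_dvd_of_dvd_one_sub_mul (k := k + 1 + 2) (by omega) ?_)
    have := mul_sub_eq_pow_mul (x := (X : ℤ[X])) (z := X ^ k) (S := expand ℤ 2 S) (T := T)
      (T' := expand ℤ 2 T) (s := e + f) (d := e - f) (d' := expand ℤ 2 (e - f)) ?_ ?_ ?_ ?_ ?_
    · refine ⟨_, Eq.trans ?_ (this.trans (congrArg (· * _) ?_))⟩ <;> ring
    · rw [sub_eq_iff_eq_add'.mp hS]
      simp
    · rw [← hT]
      ring
    · rw [hsum, mul_add, mul_add, mul_neg_geom_sum]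
      ring
    · rw [hdiff]
      ring
    · rw [hdiff]
      simp only [map_add, map_sub, map_mul, map_pow, map_one, map_ofNat, expand_X]
      ring
  have hc := X_pow_dvd_iff.mp hdvd n (by omega)
  rw [show (e + f) * (e - f) = e ^ 2 - f ^ 2 by ring, map_sub, coeff_sub, coeff_sub, coeff_sub,
    he, hf, coeff_indicatorPoly_sq _ (by omega), coeff_indicatorPoly_sq _ (by omega)] at hc
  omega
end

section
/- Let r₁, r₂, m be integers with 0 < r₁ < r₂ < r₁ + r₂ ≤ m and r₁ even. Let C and D be sets of nonnegative integers such that C ∪ D = [0, m], C ∩ D = {r₁, r₂}, and 0 ∈ C. If R_C(n) = R_D(n) for every integer n ∈ [0, m], then r₂ = r₁ + 1. -/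
open Finset in
/-- The ordered representations of `n` are the pairs counted twice by `R`, and the diagonal. -/
theorem sum_antidiagonal_indicator (S : Set ℕ) (n : ℕ) :
    ∑ p ∈ antidiagonal n, S.indicator (1 : ℕ → ℤ) p.1 * S.indicator 1 p.2 =
      2 * R S n + if Even n then S.indicator 1 (n / 2) else 0 := by
  classical
  set c : ℕ → ℤ := S.indicator 1 with hc
  have hlt : (R S n : ℤ) = ∑ p ∈ antidiagonal n, if p.1 < p.2 then c p.1 * c p.2 else 0 := by
    have hset : {p : ℕ × ℕ | p.1 ∈ S ∧ p.2 ∈ S ∧ p.1 < p.2 ∧ p.1 + p.2 = n} =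
        ((antidiagonal n).filter fun p => p.1 ∈ S ∧ p.2 ∈ S ∧ p.1 < p.2 : Finset (ℕ × ℕ)) := by
      ext p
      simp
      tauto
    rw [R, hset, Set.ncard_coe_finset, card_filter]
    push_cast
    refine sum_congr rfl fun p _ => ?_
    by_cases h1 : p.1 ∈ S <;> by_cases h2 : p.2 ∈ S <;> simp [hc, h1, h2]
  have hgt : (R S n : ℤ) = ∑ p ∈ antidiagonal n, if p.2 < p.1 then c p.1 * c p.2 else 0 := by
    rw [hlt, ← Finset.Nat.sum_antidiagonal_swap]
    exact sum_congr rfl fun p _ => by simp [mul_comm]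
  have heq : (if Even n then c (n / 2) else 0) =
      ∑ p ∈ antidiagonal n, if p.1 = p.2 then c p.1 * c p.2 else 0 := by
    split_ifs with hn
    · obtain ⟨k, rfl⟩ := hn
      rw [sum_eq_single (k, k)]
      · have : (k + k) / 2 = k := by omega
        by_cases h : k ∈ S <;> simp [hc, this, h]
      · rintro ⟨x, y⟩ hxy hne
        rw [HasAntidiagonal.mem_antidiagonal] at hxy
        simp only [ne_eq, Prod.mk.injEq] at hne hxy
        rw [if_neg]
        omega
      · simp
    · refine (sum_eq_zero fun p hp => ?_).symm
      rw [HasAntidiagonal.mem_antidiagonal] at hp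
      rw [if_neg]
      rintro h
      exact hn ⟨p.1, by omega⟩
  rw [heq, two_mul]
  nth_rewrite 1 [hlt]
  rw [hgt, ← sum_add_distrib, ← sum_add_distrib]
  refine sum_congr rfl fun p _ => ?_
  rcases lt_trichotomy p.1 p.2 with h | h | h
  · simp [h, h.ne, h.not_gt]
  · simp [h]
  · simp [h, h.ne', h.not_gt]

open Finset in
theorem sum_range_indicator_sub {r₁ r₂ m : ℕ} (h₂ : r₁ < r₂) {C D : Set ℕ}
    (hU : C ∪ D = Set.Icc 0 m) (hI : C ∩ D = {r₁, r₂})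
    (hR : ∀ n ≤ m, R C n = R D n) {f : ℕ → ℤ}
    (hf : ∀ n, f n = C.indicator 1 n - D.indicator 1 n) {n : ℕ} (hn : n ≤ m) :
    ∑ i ∈ range (n + 1), f i + (if r₁ ≤ n then f (n - r₁) else 0)
      + (if r₂ ≤ n then f (n - r₂) else 0) = if Even n then f (n / 2) else 0 := by
  set c : ℕ → ℤ := C.indicator 1 with hc
  set d : ℕ → ℤ := D.indicator 1 with hd
  have hg : ∀ k ≤ m, c k + d k = 1 + (if r₁ = k then 1 else 0) + (if r₂ = k then 1 else 0) := by
    intro k hk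
    have h1 : k ∈ C ∨ k ∈ D := by
      have : k ∈ C ∪ D := by rw [hU]; simpa using hk
      exact this
    have h2 : k ∈ C ∧ k ∈ D ↔ k = r₁ ∨ k = r₂ := by
      have : k ∈ C ∩ D ↔ k ∈ ({r₁, r₂} : Set ℕ) := by rw [hI]
      simpa using this
    by_cases hC : k ∈ C <;> by_cases hD : k ∈ D <;> simp [hc, hd, hC, hD] at h1 h2 ⊢
    · rcases h2 with rfl | rfl
      · simp [h₂.ne']
      · simp [h₂.ne]
    · rw [if_neg (Ne.symm h2.1), if_neg (Ne.symm h2.2)]; simp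
    · rw [if_neg (Ne.symm h2.1), if_neg (Ne.symm h2.2)]; simp
  have hswap : ∑ p ∈ antidiagonal n, c p.1 * d p.2 = ∑ p ∈ antidiagonal n, d p.1 * c p.2 := by
    rw [← Finset.Nat.sum_antidiagonal_swap]
    exact sum_congr rfl fun p _ => by simp [mul_comm]
  have hconv : ∑ p ∈ antidiagonal n, (c p.1 + d p.1) * f p.2 = if Even n then f (n / 2) else 0 := by
    have hCn := sum_antidiagonal_indicator C n
    have hDn := sum_antidiagonal_indicator D n
    rw [hR n hn] at hCn
    have : ∑ p ∈ antidiagonal n, (c p.1 + d p.1) * f p.2 =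
        ∑ p ∈ antidiagonal n, c p.1 * c p.2 - ∑ p ∈ antidiagonal n, d p.1 * d p.2
        + (∑ p ∈ antidiagonal n, d p.1 * c p.2 - ∑ p ∈ antidiagonal n, c p.1 * d p.2) := by
      simp only [← sum_sub_distrib, ← sum_add_distrib]
      exact sum_congr rfl fun p _ => by rw [hf]; ring
    rw [this, hswap, hCn, hDn]
    split_ifs
    · rw [hf]; ring
    · ring
  rw [← hconv, Finset.Nat.sum_antidiagonal_eq_sum_range_succ_mk, ← sum_range_reflect f (n + 1)]
  have : ∀ i ∈ range n.succ, (c i + d i) * f (n - i) = f (n + 1 - 1 - i)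
      + (if r₁ = i then f (n - i) else 0) + (if r₂ = i then f (n - i) else 0) := by
    intro i hi
    rw [mem_range] at hi
    rw [hg i (by omega)]
    split_ifs <;> simp <;> ring
  rw [sum_congr rfl this, sum_add_distrib, sum_add_distrib, sum_ite_eq, sum_ite_eq]
  simp

/-- The Thue–Morse sequence with values in `{1, -1}`. -/
def thueMorse (n : ℕ) : ℤ :=
  if n = 0 then 1 else if n % 2 = 0 then thueMorse (n / 2) else -thueMorse (n / 2)
termination_by n
decreasing_by all_goals omega

namespace thueMorse

theorem apply_zero : thueMorse 0 = 1 := by rw [thueMorse]; simp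

theorem apply_two_mul (n : ℕ) : thueMorse (2 * n) = thueMorse n := by
  rcases Nat.eq_zero_or_pos n with rfl | h
  · rfl
  · rw [thueMorse, if_neg (by omega), if_pos (by omega)]
    congr 1
    omega

theorem apply_two_mul_add_one (n : ℕ) : thueMorse (2 * n + 1) = -thueMorse n := by
  rw [thueMorse, if_neg (by omega), if_neg (by omega)]
  congr 2
  omega

theorem eq_one_or_neg_one (n : ℕ) : thueMorse n = 1 ∨ thueMorse n = -1 := by
  induction n using Nat.strong_induction_on with
  | _ n ih =>
    obtain ⟨k, rfl | rfl⟩ := Nat.even_or_odd' n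
    · rcases Nat.eq_zero_or_pos k with rfl | h
      · exact Or.inl apply_zero
      · rw [apply_two_mul]; exact ih k (by omega)
    · rw [apply_two_mul_add_one]
      rcases ih k (by omega) with h | h <;> simp [h]

theorem apply_pow_mul (a n : ℕ) : thueMorse (2 ^ a * n) = thueMorse n := by
  induction a with
  | zero => simp
  | succ a ih => rw [pow_succ', mul_assoc, apply_two_mul, ih]

theorem apply_pow (a : ℕ) : thueMorse (2 ^ a) = -1 := by
  have h := apply_pow_mul a 1
  rwa [mul_one, show (1 : ℕ) = 2 * 0 + 1 from rfl, apply_two_mul_add_one, apply_zero] at h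

/-- No shift by `e` negates the Thue–Morse sequence at the three indices `0`, `2 ^ c`,
`2 ^ (c + 1)`, where `2 ^ c` is the exact power of two dividing `e`. -/
theorem not_neg_shift (c p : ℕ) (h0 : thueMorse (2 ^ c * (2 * p + 1)) = -1)
    (h1 : thueMorse (2 ^ c * (2 * p + 1) + 2 ^ c) = 1) :
    0 < p ∧ thueMorse (2 ^ c * (2 * p + 1) + 2 ^ (c + 1)) ≠ 1 := by
  rw [apply_pow_mul, apply_two_mul_add_one] at h0
  rw [show 2 ^ c * (2 * p + 1) + 2 ^ c = 2 ^ c * (2 * (p + 1)) by ring, apply_pow_mul, apply_two_mul] at h1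
  rw [show 2 ^ c * (2 * p + 1) + 2 ^ (c + 1) = 2 ^ c * (2 * (p + 1) + 1) by ring, apply_pow_mul,
    apply_two_mul_add_one, h1]
  refine ⟨Nat.pos_of_ne_zero ?_, by norm_num⟩
  rintro rfl
  have := apply_two_mul_add_one 0
  rw [apply_zero] at this
  norm_num at this h1
  omega

end thueMorse

open thueMorse in
/-- The combinatorial core: the difference of the two indicator functions starts as the
Thue–Morse sequence, and a gap `r₂ - r₁ ≥ 2` would force a value outside `{-1, 0, 1}`. -/
theorem eq_add_one_of_recurrence {h r₂ m : ℕ} (hh : 0 < h) (hlt : 2 * h < r₂)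
    (hm : 2 * h + r₂ ≤ m) {f : ℕ → ℤ} (f0 : f 0 = 1) (fbd : ∀ n, -1 ≤ f n ∧ f n ≤ 1)
    (fr₁ : f (2 * h) = 0) (fr₂ : f r₂ = 0)
    (hrec : ∀ n ≤ m, ∑ i ∈ Finset.range (n + 1), f i
      + (if 2 * h ≤ n then f (n - 2 * h) else 0) + (if r₂ ≤ n then f (n - r₂) else 0) =
      if Even n then f (n / 2) else 0) :
    r₂ = 2 * h + 1 := by
  have odd_step : ∀ k, 2 * k + 1 ≤ m → f (2 * k + 1)
      + ((if 2 * h ≤ 2 * k + 1 then f (2 * k + 1 - 2 * h) else 0)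
        - (if 2 * h ≤ 2 * k then f (2 * k - 2 * h) else 0))
      + ((if r₂ ≤ 2 * k + 1 then f (2 * k + 1 - r₂) else 0)
        - (if r₂ ≤ 2 * k then f (2 * k - r₂) else 0)) = - f k := by
    intro k hk
    have e1 := hrec (2 * k + 1) hk
    have e2 := hrec (2 * k) (by omega)
    rw [if_neg (show ¬ Even (2 * k + 1) by simp), Finset.sum_range_succ] at e1
    rw [if_pos (show Even (2 * k) by simp), show 2 * k / 2 = k by omega] at e2
    linarith
  have even_step : ∀ k, 2 * k + 2 ≤ 2 * h → f (2 * k + 2)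
      + (if 2 * h ≤ 2 * k + 2 then f (2 * k + 2 - 2 * h) else 0) = f (k + 1) := by
    intro k hk
    have e1 := hrec (2 * k + 2) (by omega)
    have e2 := hrec (2 * k + 1) (by omega)
    rw [if_neg (show ¬ Even (2 * k + 1) by simp), if_neg (by omega), if_neg (by omega)] at e2
    rw [if_pos (show Even (2 * k + 2) from ⟨k + 1, by ring⟩), Finset.sum_range_succ,
      if_neg (show ¬ r₂ ≤ 2 * k + 2 by omega), show (2 * k + 2) / 2 = k + 1 by omega] at e1
    linarith
  have ft : ∀ n < 2 * h, f n = thueMorse n := by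
    intro n
    induction n using Nat.strong_induction_on with
    | _ n ih =>
      intro hn
      obtain ⟨k, rfl | rfl⟩ := Nat.even_or_odd' n
      · rcases k with _ | k
        · exact f0.trans apply_zero.symm
        · have := even_step k (by omega)
          rw [if_neg (by omega), ih (k + 1) (by omega) (by omega)] at this
          rw [show 2 * (k + 1) = 2 * k + 2 by ring, add_zero] at *
          rw [this, show 2 * k + 2 = 2 * (k + 1) by ring, apply_two_mul]
      · have := odd_step k (by omega)
        rw [if_neg (by omega), if_neg (by omega), if_neg (by omega), if_neg (by omega),
          ih k (by omega) (by omega)] at this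
        rw [apply_two_mul_add_one]
        simpa using this
  have th : thueMorse h = 1 := by
    obtain ⟨k, rfl⟩ : ∃ k, h = k + 1 := ⟨h - 1, by omega⟩
    have := even_step k (by omega)
    rw [if_pos (by omega), show 2 * k + 2 - 2 * (k + 1) = 0 by omega, f0,
      show 2 * k + 2 = 2 * (k + 1) by ring, fr₁, ft (k + 1) (by omega)] at this
    linarith
  -- the constraint coming from the odd index `2 * h + (2 * j + 1)`
  have key : ∀ j < h, f (2 * h + (2 * j + 1)) = -thueMorse (h + j) + 2 * thueMorse j
      - ((if r₂ ≤ 2 * (h + j) + 1 then f (2 * (h + j) + 1 - r₂) else 0)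
        - (if r₂ ≤ 2 * (h + j) then f (2 * (h + j) - r₂) else 0)) := by
    intro j hj
    have := odd_step (h + j) (by omega)
    rw [if_pos (show 2 * h ≤ 2 * (h + j) + 1 by omega), if_pos (show 2 * h ≤ 2 * (h + j) by omega),
      show 2 * (h + j) + 1 - 2 * h = 2 * j + 1 by omega,
      show 2 * (h + j) - 2 * h = 2 * j by omega, ft (2 * j + 1) (by omega), ft (2 * j) (by omega),
      apply_two_mul_add_one, apply_two_mul, ft (h + j) (by omega)] at this
    rw [show 2 * h + (2 * j + 1) = 2 * (h + j) + 1 by ring]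
    linarith
  have before : ∀ j < h, 2 * h + (2 * j + 1) < r₂ →
      f (2 * h + (2 * j + 1)) = -thueMorse (h + j) + 2 * thueMorse j := by
    intro j hj hjr
    rw [key j hj, if_neg (by omega), if_neg (by omega)]
    ring
  have before' : ∀ j < h, 2 * h + (2 * j + 1) < r₂ → thueMorse (h + j) = thueMorse j := by
    intro j hj hjr
    have h1 := before j hj hjr
    have h2 := fbd (2 * h + (2 * j + 1))
    rcases eq_one_or_neg_one (h + j) with h3 | h3 <;> rcases eq_one_or_neg_one j with h4 | h4 <;>
      rw [h3, h4] at h1 ⊢ <;> omega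
  by_contra hne
  obtain ⟨a, q, hq⟩ : ∃ a q, h = 2 ^ a * (2 * q + 1) := by
    obtain ⟨a, n, ⟨q, rfl⟩, hn⟩ := Nat.exists_eq_two_pow_mul_odd hh.ne'
    exact ⟨a, q, hn⟩
  have tq : thueMorse q = -1 := by
    rw [hq, apply_pow_mul, apply_two_mul_add_one] at th
    omega
  have hq1 : 1 ≤ q := by
    rcases Nat.eq_zero_or_pos q with rfl | hq0
    · rw [apply_zero] at tq; omega
    · exact hq0
  have ha : 0 < 2 ^ a := by positivity
  have h3a : 3 * 2 ^ a ≤ h := by rw [hq]; nlinarith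
  -- `2 ^ b` is a small index where the shift by `h` changes the sign
  obtain ⟨b, hb, hS⟩ : ∃ b, (b = a ∨ b = a + 1) ∧ thueMorse (h + 2 ^ b) = 1 := by
    rcases eq_one_or_neg_one (q + 1) with h1 | h1
    · refine ⟨a, Or.inl rfl, ?_⟩
      rw [hq, show 2 ^ a * (2 * q + 1) + 2 ^ a = 2 ^ a * (2 * (q + 1)) by ring, apply_pow_mul, apply_two_mul, h1]
    · refine ⟨a + 1, Or.inr rfl, ?_⟩
      rw [hq, show 2 ^ a * (2 * q + 1) + 2 ^ (a + 1) = 2 ^ a * (2 * (q + 1) + 1) by ring, apply_pow_mul,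
        apply_two_mul_add_one, h1]
      norm_num
  have hS2 : 2 ^ b ≤ 2 * 2 ^ a := by
    rcases hb with rfl | rfl
    · omega
    · rw [pow_succ']
  have hSr : r₂ ≤ 2 * h + (2 * 2 ^ b + 1) := by
    by_contra hcon
    have := before' (2 ^ b) (by omega) (by omega)
    rw [hS, apply_pow] at this
    omega
  obtain ⟨e, he⟩ := Nat.even_or_odd' (r₂ - 2 * h)
  rcases he with he | he
  · have hr : r₂ = 2 * h + 2 * e := by omega
    have shift : ∀ i, e + i < h → thueMorse (e + i) = -thueMorse i := by
      intro i hi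
      have h1 := key (e + i) hi
      rw [if_pos (by omega), if_pos (by omega),
        show 2 * (h + (e + i)) + 1 - r₂ = 2 * i + 1 by omega,
        show 2 * (h + (e + i)) - r₂ = 2 * i by omega, ft (2 * i + 1) (by omega),
        ft (2 * i) (by omega),
        apply_two_mul_add_one, apply_two_mul] at h1
      have h2 := fbd (2 * h + (2 * (e + i) + 1))
      rcases eq_one_or_neg_one (h + (e + i)) with h3 | h3 <;>
        rcases eq_one_or_neg_one (e + i) with h4 | h4 <;>
        rcases eq_one_or_neg_one i with h5 | h5 <;> rw [h3, h4, h5] at h1 <;> rw [h4, h5] <;> omega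
    have heS : e ≤ 2 * 2 ^ a := by omega
    obtain ⟨c, p, hp⟩ : ∃ c p, e = 2 ^ c * (2 * p + 1) := by
      obtain ⟨c, n, ⟨p, rfl⟩, hn⟩ := Nat.exists_eq_two_pow_mul_odd (show e ≠ 0 by omega)
      exact ⟨c, p, hn⟩
    have hc : 0 < 2 ^ c := by positivity
    have t0 : thueMorse e = -1 := by simpa [apply_zero] using shift 0 (by omega)
    have hce : 2 ^ c ≤ e := by rw [hp]; nlinarith
    have hca : c ≤ a + 1 := by
      rw [← Nat.pow_le_pow_iff_right (show 1 < 2 by norm_num), pow_succ']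
      omega
    obtain ⟨k, hk⟩ := Nat.exists_eq_add_of_le hca
    have hpk : 2 * p + 1 ≤ 2 ^ k := by
      have : 2 ^ c * (2 * p + 1) ≤ 2 ^ c * 2 ^ k := by rw [← pow_add, ← hk, ← hp, pow_succ']; exact heS
      exact Nat.le_of_mul_le_mul_left this hc
    have hmul : 2 ^ c * 2 ^ k = 2 * 2 ^ a := by rw [← pow_add, ← hk, pow_succ']
    by_cases hsp : k = 0 ∧ q = 1
    · -- here `h = 3 * 2 ^ a` and `e = 2 ^ (a + 1)`
      obtain ⟨rfl, rfl⟩ := hsp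
      have hp0 : p = 0 := by omega
      subst hp0
      have h1 := odd_step (2 * h) (by omega)
      have h2 := before 0 hh (by omega)
      rw [add_zero, th, apply_zero] at h2
      have hea : e = 2 ^ c := by omega
      rw [if_pos (by omega), if_pos (by omega), if_pos (by omega), if_pos (by omega), fr₁,
        show 2 * (2 * h) + 1 - 2 * h = 2 * h + (2 * 0 + 1) by omega,
        show 2 * (2 * h) - 2 * h = 2 * h by omega, fr₁, h2,
        show 2 * (2 * h) + 1 - r₂ = 2 * 2 ^ a + 1 by omega,
        show 2 * (2 * h) - r₂ = 2 * 2 ^ a by omega, ft (2 * 2 ^ a + 1) (by omega),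
        ft (2 * 2 ^ a) (by omega), apply_two_mul_add_one, apply_two_mul, apply_pow] at h1
      have h3 := fbd (2 * (2 * h) + 1)
      omega
    · have hlt₁ : e + 2 ^ c < h ∧ (0 < p → e + 2 ^ (c + 1) < h) := by
        rw [pow_succ']
        rcases Nat.eq_zero_or_pos p with rfl | hp0
        · refine ⟨?_, by omega⟩
          rcases Nat.eq_zero_or_pos k with rfl | hk0
          · have : 5 * 2 ^ a ≤ h := by
              have : 2 ≤ q := by omega
              rw [hq]; nlinarith
            omega
          · have : 2 ^ c * 2 ≤ 2 ^ c * 2 ^ k :=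
              Nat.mul_le_mul_left _ (Nat.le_self_pow hk0.ne' 2)
            omega
        · obtain ⟨l, rfl⟩ : ∃ l, k = l + 2 := by
            rcases k with _ | _ | l
            · omega
            · omega
            · exact ⟨l, rfl⟩
          have h4 : 2 ^ (l + 2) = 4 * 2 ^ l := by ring
          have hl : 0 < 2 ^ l := by positivity
          have h5 : 2 ^ c * (2 * p + 2) ≤ 2 ^ c * 2 ^ (l + 2) := Nat.mul_le_mul_left _ (by omega)
          have h6 : 2 ^ c * 4 ≤ 2 ^ c * 2 ^ (l + 2) := Nat.mul_le_mul_left _ (by omega)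
          have h7 : 2 ^ c * (2 * p + 2) = e + 2 ^ c := by rw [hp]; ring
          omega
      have t1 := shift (2 ^ c) hlt₁.1
      rw [apply_pow, neg_neg, hp] at t1
      obtain ⟨hp0, hne1⟩ := not_neg_shift c p (hp ▸ t0) t1
      apply hne1
      rw [← hp, shift _ (hlt₁.2 hp0), apply_pow, neg_neg]
  · have hr : r₂ = 2 * h + (2 * e + 1) := by omega
    have h1 := key e (by omega)
    rw [← hr, fr₂, if_pos (by omega), if_neg (by omega),
      show 2 * (h + e) + 1 - r₂ = 0 by omega, f0] at h1
    have te : thueMorse e = 1 ∧ thueMorse (h + e) = 1 := by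
      rcases eq_one_or_neg_one (h + e) with h3 | h3 <;>
        rcases eq_one_or_neg_one e with h4 | h4 <;> rw [h3, h4] at h1 <;> omega
    have heS : e ≠ 2 ^ b := by
      rintro rfl
      rw [apply_pow] at te
      omega
    have t1 : thueMorse 1 = -1 := apply_pow 0
    have after : ∀ i, e + (i + 1) < h → thueMorse (h + (e + (i + 1))) = -thueMorse (e + (i + 1)) →
        thueMorse (i + 1) = thueMorse (e + (i + 1)) ∧ thueMorse i = thueMorse (e + (i + 1)) := by
      intro i hi hneg
      have h1 := key (e + (i + 1)) hi
      rw [if_pos (by omega), if_pos (by omega),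
        show 2 * (h + (e + (i + 1))) + 1 - r₂ = 2 * (i + 1) by omega,
        show 2 * (h + (e + (i + 1))) - r₂ = 2 * i + 1 by omega, ft (2 * (i + 1)) (by omega),
        ft (2 * i + 1) (by omega),
        apply_two_mul_add_one, apply_two_mul, hneg] at h1
      have h2 := fbd (2 * h + (2 * (e + (i + 1)) + 1))
      rcases eq_one_or_neg_one (e + (i + 1)) with h3 | h3 <;>
        rcases eq_one_or_neg_one (i + 1) with h4 | h4 <;>
        rcases eq_one_or_neg_one i with h5 | h5 <;> rw [h3, h4, h5] at h1 <;> rw [h3, h4, h5] <;> omega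
    rcases Nat.eq_zero_or_pos a with rfl | ha0
    · have : e = 1 := by omega
      rw [this, t1] at te
      omega
    · obtain ⟨a', rfl⟩ : ∃ a', a = a' + 1 := ⟨a - 1, by omega⟩
      obtain ⟨b', rfl⟩ : ∃ b', b = b' + 1 := ⟨b - 1, by omega⟩
      have hpow : 2 ^ (b' + 1) = 2 * 2 ^ b' := pow_succ' 2 b'
      have hpow' : 2 ^ (a' + 1) = 2 * 2 ^ a' := pow_succ' 2 a'
      obtain ⟨i, hi⟩ : ∃ i, 2 ^ (b' + 1) = e + (i + 1) := ⟨2 ^ (b' + 1) - e - 1, by omega⟩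
      have tS := apply_pow (b' + 1)
      have tS1 : thueMorse (2 ^ (b' + 1) + 1) = 1 := by
        rw [hpow, apply_two_mul_add_one, apply_pow]; norm_num
      have thS1 : thueMorse (h + (2 ^ (b' + 1) + 1)) = -1 := by
        have hev : h + 2 ^ (b' + 1) = 2 * (2 ^ a' * (2 * q + 1) + 2 ^ b') := by
          rw [hq]; ring
        rw [← add_assoc, hev, apply_two_mul_add_one, ← apply_two_mul, ← hev, hS]
      have c1 := after i (by omega) (by rw [← hi, hS, tS]; norm_num)
      have c2 := after (i + 1) (by omega) (by
        rw [← add_assoc e (i + 1) 1, ← hi, thS1, tS1])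
      rw [← hi, tS] at c1
      rw [← add_assoc e (i + 1) 1, ← hi, tS1] at c2
      omega

theorem stmt_9 (r₁ r₂ m : ℕ) (h₁ : 0 < r₁) (h₂ : r₁ < r₂) (h₃ : r₂ < r₁ + r₂)
    (h₄ : r₁ + r₂ ≤ m) (h₅ : Even r₁) (C D : Set ℕ)
    (hU : C ∪ D = Set.Icc 0 m) (hI : C ∩ D = {r₁, r₂}) (h0 : 0 ∈ C)
    (hR : ∀ n ≤ m, R C n = R D n) :
    r₂ = r₁ + 1 := by
  obtain ⟨h, rfl⟩ := h₅.exists_two_nsmul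
  rw [smul_eq_mul] at *
  have hmem : ∀ x, x ∈ C ∧ x ∈ D ↔ x = 2 * h ∨ x = r₂ := by
    intro x
    have : x ∈ C ∩ D ↔ x ∈ ({2 * h, r₂} : Set ℕ) := by rw [hI]
    simpa using this
  have hD : 0 ∉ D := fun hD => by
    have := (hmem 0).1 ⟨h0, hD⟩
    omega
  have hr₁ := (hmem (2 * h)).2 (Or.inl rfl)
  have hr₂ := (hmem r₂).2 (Or.inr rfl)
  refine eq_add_one_of_recurrence (m := m)
    (f := fun n => C.indicator (1 : ℕ → ℤ) n - D.indicator 1 n) (by omega) h₂ h₄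
    (by simp [h0, hD]) (fun n => ?_) (by simp [hr₁]) (by simp [hr₂])
    (fun n hn => sum_range_indicator_sub h₂ hU hI hR (fun _ => rfl) hn)
  by_cases hC : n ∈ C <;> by_cases hD' : n ∈ D <;> simp [hC, hD']
end
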